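/- C(n)=0 for 1≤n≤57. For n≥58, let m be the unique integer with t_{m-1}+2t_{m-4} ≤ n < t_m+2t_{m-3} (necessarily m≥7); then C(n) = n − (4t_{m-1}−t_{m-2}−3t_{m-3}+m−6)/2 if n ≤ (3t_{m-1}−t_{m-3}−3)/2, and C(n) = (t_{m-5}+t_{m-6}−m+3)/2 otherwise. -/

import Mathlib

/-- The three-letter alphabet of the Tribonacci word. -/
inductive TLetter : Type
  | a | b | c
deriving DecidableEq

/-- The Tribonacci substitution σ(a)=ab, σ(b)=ac, σ(c)=a. -/
def tsubst : TLetter → List TLetter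
  | .a => [.a, .b]
  | .b => [.a, .c]
  | .c => [.a]

/-- `Tword m = σ^m(a)`, the m-th finite Tribonacci word. -/
def Tword : ℕ → List TLetter
  | 0 => [.a]
  | n + 1 => (Tword n).flatMap tsubst

/-- The prefix 𝕋[1,n] of the Tribonacci word of length n
(each `Tword n` is a prefix of the next and has length ≥ n). -/
def TPrefix (n : ℕ) : List TLetter := (Tword n).take n

/-- A word is a factor of the Tribonacci word 𝕋. -/
def IsFactorT (w : List TLetter) : Prop := ∃ m, w <:+: Tword m

/-- `tribAux i = t_{i-2}`: Tribonacci numbers, shifted so that the index is a natural. -/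
def tribAux : ℕ → ℕ
  | 0 => 0
  | 1 => 1
  | 2 => 1
  | n + 3 => tribAux (n + 2) + tribAux (n + 1) + tribAux n

/-- The Tribonacci numbers `t m` for `m : ℤ`: t₋₂=0, t₋₁=1, t₀=1,
`t m = t (m-1) + t (m-2) + t (m-3)` for m ≥ 1. (Junk value 0 below -2.) -/
def t (m : ℤ) : ℕ := tribAux (m + 2).toNat

/-- Kernel numbers: k₀=0, k₁=k₂=1, `k m = k (m-1) + k (m-2) + k (m-3) - 1` for m ≥ 3. -/
def kAux : ℕ → ℕ
  | 0 => 0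
  | 1 => 1
  | 2 => 1
  | n + 3 => kAux (n + 2) + kAux (n + 1) + kAux n - 1

def kker (m : ℤ) : ℕ := kAux m.toNat

/-- `A n`: the number of distinct nonempty words w with ww a factor of 𝕋[1,n]. -/
noncomputable def A (n : ℕ) : ℕ := Nat.card {w : List TLetter // w ≠ [] ∧ (w ++ w) <:+: TPrefix n}

/-- `B n`: the number of occurrences of squares in 𝕋[1,n], i.e. of pairs (w,i) with
w nonempty, i ≥ 1, ww occurring in 𝕋 at position i and i + 2|w| - 1 ≤ n. -/
noncomputable def B (n : ℕ) : ℕ :=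
  Nat.card {p : List TLetter × ℕ // p.1 ≠ [] ∧ 1 ≤ p.2 ∧
    p.2 + 2 * p.1.length - 1 ≤ n ∧ (p.1 ++ p.1) <+: (TPrefix n).drop (p.2 - 1)}

/-- `C n`: the number of distinct nonempty words w with www a factor of 𝕋[1,n]. -/
noncomputable def C (n : ℕ) : ℕ := Nat.card {w : List TLetter // w ≠ [] ∧ (w ++ w ++ w) <:+: TPrefix n}

/-- `D n`: the number of occurrences of cubes in 𝕋[1,n], i.e. of pairs (w,i) with
w nonempty, i ≥ 1, www occurring in 𝕋 at position i and i + 3|w| - 1 ≤ n. -/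
noncomputable def D (n : ℕ) : ℕ :=
  Nat.card {p : List TLetter × ℕ // p.1 ≠ [] ∧ 1 ≤ p.2 ∧
    p.2 + 3 * p.1.length - 1 ≤ n ∧ (p.1 ++ p.1 ++ p.1) <+: (TPrefix n).drop (p.2 - 1)}

namespace Tribonacci

/-! ### The infinite word -/

theorem tword_prefix_succ (m : ℕ) : Tword m <+: Tword (m + 1) := by
  induction m with
  | zero => exact ⟨[.b], rfl⟩
  | succ m ih =>
    obtain ⟨v, hv⟩ := ih
    refine ⟨v.flatMap tsubst, ?_⟩
    change (Tword m).flatMap tsubst ++ _ = (Tword (m + 1)).flatMap tsubst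
    rw [← hv, List.flatMap_append]

theorem tword_prefix_of_le {m n : ℕ} (h : m ≤ n) : Tword m <+: Tword n := by
  induction n, h using Nat.le_induction with
  | base => exact List.prefix_rfl
  | succ n _ ih => exact ih.trans (tword_prefix_succ n)

theorem length_le_length_flatMap_tsubst (l : List TLetter) :
    l.length ≤ (l.flatMap tsubst).length := by
  induction l with
  | nil => simp
  | cons x l ih =>
    rw [List.flatMap_cons, List.length_append, List.length_cons]
    cases x <;> simp only [tsubst, List.length_cons, List.length_nil] <;> omega

theorem lt_length_tword (m : ℕ) : m < (Tword m).length := by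
  induction m with
  | zero => simp [Tword]
  | succ m ih =>
    obtain ⟨v, hv⟩ := tword_prefix_of_le (Nat.zero_le m)
    have h := length_le_length_flatMap_tsubst v
    have e : Tword (m + 1) = [.a, .b] ++ v.flatMap tsubst := by
      change (Tword m).flatMap tsubst = _
      rw [← hv, List.flatMap_append]
      rfl
    have hl : (Tword m).length = v.length + 1 := by
      rw [← hv]; simp [Tword]
    rw [e, List.length_append]
    simp only [List.length_cons, List.length_nil]
    omega

/-- The letter of the Tribonacci word at the (0-based) position `n`. -/
def letter (n : ℕ) : TLetter := (Tword n).getD n .a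

theorem tword_getElem? {m n : ℕ} (h : n < (Tword m).length) :
    (Tword m)[n]? = some (letter n) := by
  have hn := lt_length_tword n
  have key : (Tword m)[n]? = (Tword n)[n]? := by
    rcases le_total m n with hmn | hmn
    · obtain ⟨v, hv⟩ := tword_prefix_of_le hmn
      rw [← hv, List.getElem?_append_left h]
    · obtain ⟨v, hv⟩ := tword_prefix_of_le hmn
      rw [← hv, List.getElem?_append_left hn]
  rw [key, letter, List.getD_eq_getElem?_getD, List.getElem?_eq_getElem hn]
  rfl

theorem take_tword {m n : ℕ} (h : n ≤ (Tword m).length) :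
    (Tword m).take n = (List.range n).map letter := by
  apply List.ext_getElem?
  intro i
  by_cases hi : i < n
  · rw [List.getElem?_take_of_lt hi, tword_getElem? (by omega)]
    simp [hi]
  · rw [List.getElem?_eq_none (by simp; omega), List.getElem?_eq_none (by simp; omega)]

theorem tprefix_eq (n : ℕ) : TPrefix n = (List.range n).map letter :=
  take_tword (lt_length_tword n).le

/-- The position at which the image under the substitution of the letter at position `n` starts. -/
def pos (n : ℕ) : ℕ := (((List.range n).map letter).flatMap tsubst).length

theorem pos_zero : pos 0 = 0 := rfl

theorem pos_succ (n : ℕ) : pos (n + 1) = pos n + (tsubst (letter n)).length := by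
  simp [pos, List.range_succ]

theorem letter_pos_add {n i : ℕ} (hi : i < (tsubst (letter n)).length) :
    (tsubst (letter n))[i]? = some (letter (pos n + i)) := by
  have hn := lt_length_tword n
  have e : Tword n = (List.range n).map letter ++ letter n :: (Tword n).drop (n + 1) := by
    have h := tword_getElem? hn
    rw [List.getElem?_eq_getElem hn, Option.some.injEq] at h
    rw [← take_tword hn.le, ← h, ← List.drop_eq_getElem_cons, List.take_append_drop]
  have e' : Tword (n + 1) = ((List.range n).map letter).flatMap tsubst ++
      (tsubst (letter n) ++ ((Tword n).drop (n + 1)).flatMap tsubst) := by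
    change (Tword n).flatMap tsubst = _
    conv_lhs => rw [e]
    rw [List.flatMap_append, List.flatMap_cons]
  have hlt : pos n + i < (Tword (n + 1)).length := by
    rw [e']; simp only [List.length_append, pos]; omega
  rw [← tword_getElem? hlt, e', List.getElem?_append_right (by simp [pos]),
    List.getElem?_append_left (by simp only [pos]; omega)]
  simp [pos]

theorem letter_pos (n : ℕ) : letter (pos n) = .a := by
  have h := @letter_pos_add n 0 (by cases letter n <;> simp [tsubst])
  cases e : letter n <;> simp_all [tsubst]

theorem pos_succ_of_ne {n : ℕ} (h : letter n ≠ .c) : pos (n + 1) = pos n + 2 := by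
  rw [pos_succ]; cases e : letter n <;> simp_all [tsubst]

theorem pos_succ_of_eq {n : ℕ} (h : letter n = .c) : pos (n + 1) = pos n + 1 := by
  rw [pos_succ, h]; rfl

theorem letter_pos_succ_a {n : ℕ} (h : letter n = .a) : letter (pos n + 1) = .b := by
  have h' := @letter_pos_add n 1 (by simp [h, tsubst])
  simp_all [tsubst]

theorem letter_pos_succ_b {n : ℕ} (h : letter n = .b) : letter (pos n + 1) = .c := by
  have h' := @letter_pos_add n 1 (by simp [h, tsubst])
  simp_all [tsubst]

theorem letter_pos_succ_c {n : ℕ} (h : letter n = .c) : letter (pos n + 1) = .a := by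
  rw [← pos_succ_of_eq h, letter_pos]

theorem letter_pos_succ_eq_iff {m n : ℕ} :
    letter (pos m + 1) = letter (pos n + 1) ↔ letter m = letter n := by
  cases hm : letter m <;> cases hn : letter n <;>
    simp [hm, hn, letter_pos_succ_a, letter_pos_succ_b, letter_pos_succ_c]

theorem pos_strictMono : StrictMono pos :=
  strictMono_nat_of_lt_succ fun n => by
    rw [pos_succ]; cases letter n <;> simp [tsubst]

theorem exists_pos_eq (z : ℕ) : ∃ y, z = pos y ∨ (z = pos y + 1 ∧ letter y ≠ .c) := by
  induction z with
  | zero => exact ⟨0, .inl rfl⟩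
  | succ z ih =>
    obtain ⟨y, rfl | ⟨rfl, hy⟩⟩ := ih
    · by_cases hy : letter y = .c
      · exact ⟨y + 1, .inl (pos_succ_of_eq hy).symm⟩
      · exact ⟨y, .inr ⟨rfl, hy⟩⟩
    · exact ⟨y + 1, .inl (pos_succ_of_ne hy).symm⟩

theorem exists_pos_of_eq_a {z : ℕ} (h : letter z = .a) : ∃ y, z = pos y := by
  obtain ⟨y, hy | ⟨rfl, hy⟩⟩ := exists_pos_eq z
  · exact ⟨y, hy⟩
  · cases e : letter y <;> simp_all [letter_pos_succ_a, letter_pos_succ_b]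

theorem exists_pos_of_ne_a {z : ℕ} (h : letter z ≠ .a) :
    ∃ y, z = pos y + 1 ∧ z + 1 = pos (y + 1) := by
  obtain ⟨y, rfl | ⟨rfl, hy⟩⟩ := exists_pos_eq z
  · exact absurd (letter_pos y) h
  · exact ⟨y, rfl, (pos_succ_of_ne hy).symm⟩

theorem letter_succ_of_ne_a {z : ℕ} (h : letter z ≠ .a) : letter (z + 1) = .a := by
  obtain ⟨y, -, hy⟩ := exists_pos_of_ne_a h
  rw [hy, letter_pos]

theorem letter_of_succ_ne_a {z : ℕ} (h : letter (z + 1) ≠ .a) : letter z = .a := by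
  by_contra h'
  exact h (letter_succ_of_ne_a h')

theorem pos_add_three_le (y : ℕ) : pos y + 3 ≤ pos (y + 2) := by
  by_cases h : letter y = .c
  · have h' : letter (y + 1) ≠ .c := by
      rw [letter_succ_of_ne_a (by simp [h])]; simp
    rw [pos_succ_of_ne h', pos_succ_of_eq h]
  · have h1 := pos_succ_of_ne h
    have h2 := pos_strictMono (Nat.lt_succ_self (y + 1))
    simp only [Nat.succ_eq_add_one, Nat.add_assoc, Nat.reduceAdd] at h2
    omega

theorem not_aaa {z : ℕ} (h0 : letter z = .a) (h1 : letter (z + 1) = .a)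
    (h2 : letter (z + 2) = .a) : False := by
  obtain ⟨y, rfl⟩ := exists_pos_of_eq_a h0
  have hc : letter y = .c := by
    cases e : letter y <;> simp_all [letter_pos_succ_a, letter_pos_succ_b]
  have hc' : letter (y + 1) = .c := by
    have e : pos y + 2 = pos (y + 1) + 1 := by rw [pos_succ_of_eq hc]
    rw [e] at h2
    cases e : letter (y + 1) <;> simp_all [letter_pos_succ_a, letter_pos_succ_b]
  simp [letter_succ_of_ne_a (z := y) (by simp [hc])] at hc'

theorem six_le_of_aa {x : ℕ} (h0 : letter x = .a) (h1 : letter (x + 1) = .a) : 6 ≤ x := by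
  by_contra! h
  interval_cases x <;> revert h0 h1 <;> decide

/-! ### Tribonacci numbers -/

/-- `trib k` is the Tribonacci number with nonnegative index `k`, the length of `σ^k(a)`. -/
def trib (k : ℕ) : ℕ := tribAux (k + 2)

theorem trib_add_three (k : ℕ) : trib (k + 3) = trib (k + 2) + trib (k + 1) + trib k := rfl

theorem trib_zero : trib 0 = 1 := rfl

theorem trib_one : trib 1 = 2 := rfl

theorem trib_two : trib 2 = 4 := rfl

theorem trib_succ_bounds (k : ℕ) : trib k < trib (k + 1) ∧ trib (k + 1) ≤ 2 * trib k := by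
  induction k using Nat.strong_induction_on with
  | _ k ih =>
    match k with
    | 0 => decide
    | 1 => decide
    | 2 => decide
    | k + 3 =>
      have h0 := ih k (by omega)
      have h1 := ih (k + 1) (by omega)
      have h2 := ih (k + 2) (by omega)
      have := trib_add_three k
      have : trib (k + 4) = trib (k + 3) + trib (k + 2) + trib (k + 1) := rfl
      simp only [Nat.add_assoc, Nat.reduceAdd] at *
      omega

theorem trib_strictMono : StrictMono trib :=
  strictMono_nat_of_lt_succ fun k => (trib_succ_bounds k).1

/-- The `k`-th iterated image of a letter `a` has length `trib k`. -/
theorem iterate_pos_succ (k : ℕ) {x : ℕ} (h : letter x = .a) :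
    pos^[k] (x + 1) = pos^[k] x + trib k := by
  induction k using Nat.strong_induction_on generalizing x with
  | _ k ih =>
    match k with
    | 0 => rfl
    | 1 => simp [pos_succ_of_ne (n := x) (by simp [h]), trib_one]
    | 2 =>
      have h1 := pos_succ_of_ne (n := x) (by simp [h])
      have h2 := pos_succ_of_ne (n := pos x) (by simp [letter_pos])
      have h3 := pos_succ_of_ne (n := pos x + 1) (by simp [letter_pos_succ_a h])
      simp [h1, h2, h3, trib_two]
    | k + 3 =>
      have hb := letter_pos_succ_a h
      have h1 : pos (x + 1) = pos x + 1 + 1 := pos_succ_of_ne (by simp [h])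
      have h2 : pos (pos x + 1 + 1) = pos (pos x + 1) + 1 + 1 := pos_succ_of_ne (by simp [hb])
      have hc := letter_pos_succ_b hb
      have h3 : pos (pos (pos x + 1) + 1 + 1) = pos (pos (pos x + 1) + 1) + 1 :=
        pos_succ_of_eq hc
      have s1 := ih (k + 2) (by omega) (letter_pos x)
      have s2 := ih (k + 1) (by omega) (letter_pos (pos x + 1))
      have s3 := ih k (by omega) (letter_pos (pos (pos x + 1) + 1))
      simp only [Function.iterate_succ_apply] at s1 s2 s3 ⊢
      rw [h1, h2, h3, s3, s2, s1, trib_add_three]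
      ring

/-- The partial sums of the Tribonacci numbers. -/
def tribSum (k : ℕ) : ℕ := ∑ j ∈ Finset.range (k + 1), trib j

theorem tribSum_succ (k : ℕ) : tribSum (k + 1) = tribSum k + trib (k + 1) :=
  Finset.sum_range_succ _ _

theorem two_mul_tribSum (k : ℕ) : 2 * tribSum k + 3 = trib (k + 2) + trib k := by
  induction k with
  | zero => rfl
  | succ k ih =>
    have := trib_add_three k
    rw [tribSum_succ]
    simp only [Nat.add_assoc, Nat.reduceAdd] at *
    omega

theorem tribSum_lt (k : ℕ) : tribSum k < 3 * trib k := by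
  have h := two_mul_tribSum k
  have h1 := trib_succ_bounds k
  have h2 := trib_succ_bounds (k + 1)
  simp only [Nat.add_assoc, Nat.reduceAdd] at *
  omega

theorem pos_iterate_add_tribSum (k : ℕ) {x : ℕ} (h : letter x = .a) :
    pos (pos^[k] x + tribSum k) + 1 = pos^[k + 1] x + tribSum (k + 1) := by
  have key : ∀ k j, pos^[j + 1] (pos^[k] x + tribSum k) + ∑ i ∈ Finset.range (j + 1), trib i =
      pos^[j + 1 + k] x + tribSum (j + 1 + k) := by
    intro k
    induction k with
    | zero =>
      intro j
      have e : tribSum 0 = 1 := rfl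
      rw [e, Function.iterate_zero_apply, iterate_pos_succ _ h, Nat.add_zero, tribSum,
        Finset.sum_range_succ _ (j + 1)]
      ring
    | succ k ih =>
      intro j
      have h0 := ih 0
      simp only [Nat.zero_add, Finset.sum_range_one, trib_zero, Function.iterate_one] at h0
      rw [Nat.add_comm 1 k] at h0
      rw [← h0, iterate_pos_succ _ (letter_pos _), ← Function.iterate_succ_apply, Nat.add_assoc,
        Nat.add_comm (trib _), ← Finset.sum_range_succ, ih (j + 1)]
      congr 2 <;> ring_nf
  have h0 := key k 0
  simp only [Nat.zero_add, Finset.sum_range_one, trib_zero, Function.iterate_one] at h0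
  rw [Nat.add_comm 1 k] at h0
  exact h0

/-! ### Repetitions -/

/-- The letters at the positions of `[s, e)` agree with those at the positions shifted by `d`. -/
def Agree (d s e : ℕ) : Prop := ∀ y, s ≤ y → y < e → letter y = letter (y + d)

theorem Agree.pos_add {d s e D : ℕ} (h : Agree d s e) (hD : pos (s + d) = pos s + D) {y : ℕ}
    (hs : s ≤ y) (he : y ≤ e) : pos (y + d) = pos y + D := by
  induction y, hs using Nat.le_induction with
  | base => exact hD
  | succ y hy ih =>
    have := ih (by omega)
    rw [Nat.add_right_comm, pos_succ, pos_succ, ← h y hy (by omega), this]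
    ring

theorem Agree.image {d s e D : ℕ} (h : Agree d s e) (hD : pos (s + d) = pos s + D) :
    Agree D (pos s) (pos e + 1) := by
  intro z hs he
  obtain ⟨y, rfl | ⟨rfl, hy⟩⟩ := exists_pos_eq z
  · rw [← h.pos_add hD (pos_strictMono.le_iff_le.1 hs) (pos_strictMono.le_iff_le.1 (by omega)),
      letter_pos, letter_pos]
  · have hs' : s ≤ y := by
      have := pos_succ_of_ne hy
      by_contra! hc
      have := pos_strictMono.le_iff_le.2 (show y + 1 ≤ s from hc)
      omega
    have he' : y < e := pos_strictMono.lt_iff_lt.1 (by omega)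
    rw [Nat.add_right_comm, ← h.pos_add hD hs' he'.le, letter_pos_succ_eq_iff]
    exact h y hs' he'

theorem iterate_pos_mono (k : ℕ) : StrictMono pos^[k] := pos_strictMono.iterate k

theorem agree_iterate (k : ℕ) {x : ℕ} (h : letter x = .a) (h' : letter (x + 1) = .a) :
    Agree (trib k) (pos^[k] x) (pos^[k] x + tribSum k) := by
  induction k with
  | zero =>
    intro y hs he
    have e : tribSum 0 = 1 := rfl
    simp only [Function.iterate_zero_apply, e] at hs he
    obtain rfl : y = x := by omega
    rw [h, trib_zero, h']
  | succ k ih =>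
    rw [← pos_iterate_add_tribSum k h, Function.iterate_succ_apply']
    apply ih.image
    rw [← iterate_pos_succ k h, ← Function.iterate_succ_apply' pos,
      ← Function.iterate_succ_apply' pos, iterate_pos_succ _ h]

theorem agree_iterate_shift (k : ℕ) {x d : ℕ} (h : letter x = .a) (h' : letter (x + 1) = .a)
    (hd : letter (x + d) = .a) (hd' : letter (x + d + 1) = .a) :
    Agree (pos^[k] (x + d) - pos^[k] x) (pos^[k] x) (pos^[k] x + trib k + tribSum k) := by
  induction k with
  | zero =>
    intro y hs he
    have e : tribSum 0 = 1 := rfl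
    simp only [Function.iterate_zero_apply, e, trib_zero] at hs he ⊢
    obtain rfl | rfl : y = x ∨ y = x + 1 := by omega
    · rw [h, Nat.add_sub_cancel_left, hd]
    · rw [h', Nat.add_sub_cancel_left, Nat.add_right_comm, hd']
  | succ k ih =>
    have e := pos_iterate_add_tribSum k h'
    rw [iterate_pos_succ k h, iterate_pos_succ _ h] at e
    rw [← e]
    have hm := (iterate_pos_mono k).monotone (Nat.le_add_right x d)
    have hm' := (iterate_pos_mono (k + 1)).monotone (Nat.le_add_right x d)
    rw [Function.iterate_succ_apply' pos k x] at hm' ⊢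
    apply ih.image
    rw [Nat.add_sub_cancel' hm, Nat.add_sub_cancel' hm', Function.iterate_succ_apply']

/-- A repetition of exponent close to three is contained in an iterated image of `aa`. -/
theorem Agree.exists_iterate {p s e : ℕ} (hp : 0 < p) (h : Agree p s e)
    (hl : s + 2 * p ≤ e + 1) :
    ∃ k x, letter x = .a ∧ letter (x + 1) = .a ∧ p = trib k ∧ pos^[k] x ≤ s ∧
      e ≤ pos^[k] x + tribSum k := by
  induction p using Nat.strong_induction_on generalizing s e with
  | _ p ih =>
  obtain rfl | hp2 : p = 1 ∨ 2 ≤ p := by omega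
  · have h0 := h s le_rfl (by omega)
    have ha : letter s = .a := by
      by_contra hne
      exact hne (h0.trans (letter_succ_of_ne_a hne))
    refine ⟨0, s, ha, h0 ▸ ha, rfl, le_rfl, ?_⟩
    have e1 : tribSum 0 = 1 := rfl
    rw [e1, Function.iterate_zero_apply]
    by_contra! hc
    have h1 := h (s + 1) (by omega) (by omega)
    exact not_aaa ha (h0 ▸ ha) (h1.symm.trans (h0 ▸ ha))
  · obtain ⟨s₁, hs₁, ha, h₁⟩ : ∃ s₁ ≤ s, letter s₁ = .a ∧ Agree p s₁ e := by
      by_cases ha : letter s = .a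
      · exact ⟨s, le_rfl, ha, h⟩
      · obtain ⟨y, rfl, -⟩ := exists_pos_of_ne_a ha
        refine ⟨pos y, by omega, letter_pos y, fun z hz hze => ?_⟩
        obtain rfl | hz := hz.eq_or_lt
        · have hb := h (pos y + 1) le_rfl (by omega)
          rw [hb, Nat.add_right_comm] at ha
          rw [letter_pos, letter_of_succ_ne_a ha]
        · exact h z hz hze
    obtain ⟨e₁, he₁, ha', h₂⟩ : ∃ e₁, e ≤ e₁ + 1 ∧ letter e₁ = .a ∧ Agree p s₁ (e₁ + 1) := by
      obtain ⟨f, rfl⟩ : ∃ f, e = f + 1 := ⟨e - 1, by omega⟩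
      by_cases ha : letter f = .a
      · exact ⟨f, le_rfl, ha, h₁⟩
      · refine ⟨f + 1, by omega, letter_succ_of_ne_a ha, fun z hz hze => ?_⟩
        obtain rfl | hz' : z = f + 1 ∨ z < f + 1 := by omega
        · have hb := h₁ f (by omega) (by omega)
          rw [letter_succ_of_ne_a ha, Nat.add_right_comm, letter_succ_of_ne_a (hb ▸ ha)]
        · exact h₁ z hz hz'
    obtain ⟨s', rfl⟩ := exists_pos_of_eq_a ha
    obtain ⟨e', rfl⟩ := exists_pos_of_eq_a ha'
    obtain ⟨u, hu⟩ : ∃ u, pos s' + p = pos u :=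
      exists_pos_of_eq_a (by rw [← h₂ _ le_rfl (by omega), ha])
    obtain ⟨p', rfl⟩ : ∃ p', u = s' + p' :=
      Nat.exists_eq_add_of_le (pos_strictMono.le_iff_le.1 (by omega))
    have h' : Agree p' s' e' := by
      intro y hy
      induction y using Nat.strong_induction_on with
      | _ y ihy =>
        intro hye
        have hA : Agree p' s' y := fun z hz hzy => ihy z hzy hz (by omega)
        have hpos := hA.pos_add hu.symm hy le_rfl
        have h1 := pos_strictMono.monotone hy
        have h2 := pos_strictMono hye
        rw [← letter_pos_succ_eq_iff, hpos, Nat.add_right_comm]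
        exact h₂ _ (by omega) (by omega)
    have hp' : 0 < p' := by
      rcases Nat.eq_zero_or_pos p' with rfl | hp'
      · rw [Nat.add_zero] at hu; omega
      · exact hp'
    have hlt : p' < p := by
      have hgrow : ∀ j, pos s' + j ≤ pos (s' + j) := by
        intro j
        induction j with
        | zero => rfl
        | succ j ihj =>
          have := pos_strictMono (Nat.lt_succ_self (s' + j))
          rw [← Nat.add_assoc, ← Nat.add_assoc]
          exact (Nat.succ_le_succ ihj).trans this
      obtain rfl | hp'2 : p' = 1 ∨ 2 ≤ p' := by omega
      · omega
      · obtain ⟨j, rfl⟩ : ∃ j, p' = j + 2 := ⟨p' - 2, by omega⟩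
        have h1 := hgrow j
        have h2 := pos_add_three_le (s' + j)
        rw [Nat.add_assoc] at h2
        omega
    have hmid : s' + p' ≤ e' := pos_strictMono.le_iff_le.1 (by omega)
    have h2p := h'.pos_add hu.symm (Nat.le_add_right _ _) hmid
    have hl' : s' + 2 * p' ≤ e' + 1 := by
      by_contra! hc
      have h1 := pos_add_three_le e'
      have h2 := pos_strictMono.monotone (show e' + 2 ≤ s' + p' + p' by omega)
      omega
    obtain ⟨k, x, hx, hx', rfl, hxs, hxe⟩ := ih p' hlt hp' h' hl'
    refine ⟨k + 1, x, hx, hx', ?_, ?_, ?_⟩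
    · have hb : pos (pos^[k] x + trib k) = pos (pos^[k] x) + trib (k + 1) := by
        rw [← iterate_pos_succ k hx, ← Function.iterate_succ_apply' pos,
          ← Function.iterate_succ_apply' pos, iterate_pos_succ _ hx]
      have := (agree_iterate k hx hx').pos_add hb hxs (by omega)
      omega
    · rw [Function.iterate_succ_apply']
      exact (pos_strictMono.monotone hxs).trans hs₁
    · rw [← pos_iterate_add_tribSum k hx]
      have := pos_strictMono.monotone hxe
      omega

/-! ### Cubes -/

/-- The factor of length `l` of the Tribonacci word starting at position `s`. -/
def factor (s l : ℕ) : List TLetter := (List.range l).map fun i => letter (s + i)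

theorem length_factor (s l : ℕ) : (factor s l).length = l := by simp [factor]

theorem factor_add (s l₁ l₂ : ℕ) : factor s (l₁ + l₂) = factor s l₁ ++ factor (s + l₁) l₂ := by
  simp [factor, List.range_add, Nat.add_assoc]

theorem factor_eq_iff {s s' l : ℕ} :
    factor s l = factor s' l ↔ ∀ i < l, letter (s + i) = letter (s' + i) := by
  simp [factor]

theorem infix_tprefix_iff {w : List TLetter} {n : ℕ} :
    w <:+: TPrefix n ↔ ∃ s, s + w.length ≤ n ∧ w = factor s w.length := by
  have e : ∀ n, TPrefix n = factor 0 n := fun n => by simp [tprefix_eq, factor]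
  rw [e]
  constructor
  · rintro ⟨u, v, h⟩
    have hl := congrArg List.length h
    simp only [List.length_append, length_factor] at hl
    refine ⟨u.length, by omega, ?_⟩
    rw [← hl, factor_add, factor_add, Nat.zero_add] at h
    have h1 := (List.append_inj h (by simp [length_factor])).1
    exact (List.append_inj h1 (by simp [length_factor])).2
  · rintro ⟨s, hs, h⟩
    obtain ⟨r, rfl⟩ := Nat.exists_eq_add_of_le hs
    rw [factor_add, factor_add, Nat.zero_add, ← h]
    exact ⟨_, _, rfl⟩

theorem cube_infix_tprefix_iff {w : List TLetter} {n : ℕ} :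
    w ++ w ++ w <:+: TPrefix n ↔
      ∃ s p, s + 3 * p ≤ n ∧ Agree p s (s + 2 * p) ∧ w = factor s p := by
  have e : ∀ s p, factor s (p + p + p) = factor s p ++ factor (s + p) p ++ factor (s + p + p) p :=
    fun s p => by rw [factor_add, factor_add, Nat.add_assoc]
  rw [infix_tprefix_iff]
  simp only [List.length_append]
  constructor
  · rintro ⟨s, hs, h⟩
    rw [e] at h
    obtain ⟨h12, h3⟩ := List.append_inj h (by simp [length_factor])
    obtain ⟨h1, h2⟩ := List.append_inj h12 (by simp [length_factor])
    refine ⟨s, w.length, by omega, fun y hy hye => ?_, h1⟩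
    have a12 := factor_eq_iff.1 (h1.symm.trans h2)
    have a23 := factor_eq_iff.1 (h2.symm.trans h3)
    obtain ⟨i, rfl⟩ := Nat.exists_eq_add_of_le hy
    by_cases hi : i < w.length
    · rw [a12 i hi, Nat.add_right_comm]
    · obtain ⟨i, rfl⟩ := Nat.exists_eq_add_of_le (not_lt.1 hi)
      rw [← Nat.add_assoc, a23 i (by omega), Nat.add_right_comm _ i]
  · rintro ⟨s, p, hs, h, rfl⟩
    simp only [length_factor]
    refine ⟨s, by omega, ?_⟩
    have h12 : factor s p = factor (s + p) p := factor_eq_iff.2 fun i hi => by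
      rw [h (s + i) (by omega) (by omega), Nat.add_right_comm]
    have h23 : factor (s + p) p = factor (s + p + p) p := factor_eq_iff.2 fun i hi => by
      rw [h (s + p + i) (by omega) (by omega), Nat.add_right_comm]
    rw [e, ← h23, ← h12]

theorem letter_six : letter 6 = .a := by decide

theorem letter_seven : letter 7 = .a := by decide

theorem iterate_pos_six (k : ℕ) : pos^[k] 6 + trib k = trib (k + 3) := by
  have h0 : pos^[k + 3] 0 = 0 := Function.iterate_fixed pos_zero _
  have h1 := iterate_pos_succ (k + 3) (show letter 0 = .a by decide)
  have h3 : pos^[3] 1 = 7 := by decide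
  rw [← iterate_pos_succ k letter_six, ← Nat.zero_add (trib _), ← h0, ← h1,
    Function.iterate_add_apply, Nat.zero_add, h3]

/-- The root of the cube of period `trib k` at offset `o` in the first run of that period. -/
def cubeRoot (k o : ℕ) : List TLetter := factor (pos^[k] 6 + o) (trib k)

theorem cube_iff_eq_cubeRoot {w : List TLetter} {n : ℕ} :
    (w ≠ [] ∧ w ++ w ++ w <:+: TPrefix n) ↔ ∃ k o, 2 * trib k + o ≤ tribSum k ∧
      trib (k + 3) + 2 * trib k + o ≤ n ∧ w = cubeRoot k o := by
  rw [cube_infix_tprefix_iff]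
  constructor
  · rintro ⟨hw, s, p, hs, h, rfl⟩
    have hp : 0 < p := by
      rcases Nat.eq_zero_or_pos p with rfl | hp
      · exact absurd rfl hw
      · exact hp
    obtain ⟨k, x, hx, hx', rfl, hxs, hxe⟩ := h.exists_iterate hp (by omega)
    obtain ⟨d, rfl⟩ := Nat.exists_eq_add_of_le (six_le_of_aa hx hx')
    obtain ⟨o, rfl⟩ := Nat.exists_eq_add_of_le hxs
    have hm := (iterate_pos_mono k).monotone (Nat.le_add_right 6 d)
    have h6 := iterate_pos_six k
    refine ⟨k, o, by omega, by omega, factor_eq_iff.2 fun i hi => ?_⟩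
    rw [agree_iterate_shift k letter_six letter_seven hx hx' (pos^[k] 6 + o + i) (by omega)
      (by omega)]
    congr 1
    omega
  · rintro ⟨k, o, ho, hn, rfl⟩
    have hk : 0 < trib k := (Nat.zero_le _).trans_lt
      (lt_of_lt_of_le Nat.zero_lt_one (trib_strictMono.monotone (Nat.zero_le k)))
    have h6 := iterate_pos_six k
    refine ⟨fun h => ?_, _, _, ?_, fun y hy hye => ?_, rfl⟩
    · have := congrArg List.length h
      simp only [cubeRoot, length_factor, List.length_nil] at this
      omega
    · omega
    · exact agree_iterate k letter_six letter_seven y (by omega) (by omega)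

theorem cubeRoot_offset_not_lt {k o o' : ℕ} (ho : 2 * trib k + o' ≤ tribSum k)
    (h : cubeRoot k o = cubeRoot k o') : ¬ o < o' := by
  intro hlt
  obtain ⟨d, rfl⟩ := Nat.exists_eq_add_of_lt hlt
  have hk := tribSum_lt k
  have hr := agree_iterate k letter_six letter_seven
  have hA : ∀ i < 3 * trib k,
      letter (pos^[k] 6 + o + i) = letter (pos^[k] 6 + o + i + (d + 1)) := by
    intro i
    induction i using Nat.strong_induction_on with
    | _ i ih =>
      intro hi
      by_cases hik : i < trib k
      · rw [factor_eq_iff.1 h i hik]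
        congr 1
        omega
      · obtain ⟨j, rfl⟩ := Nat.exists_eq_add_of_le (not_lt.1 hik)
        have hj := ih j (by omega) (by omega)
        rw [hr (pos^[k] 6 + o + j) (by omega) (by omega),
          hr (pos^[k] 6 + o + j + (d + 1)) (by omega) (by omega)] at hj
        convert hj using 2 <;> omega
  have hA' : Agree (d + 1) (pos^[k] 6 + o) (pos^[k] 6 + o + 3 * trib k) := by
    intro y hy hye
    obtain ⟨i, rfl⟩ := Nat.exists_eq_add_of_le hy
    exact hA i (by omega)
  obtain ⟨j, x, -, -, hd, hxs, hxe⟩ := hA'.exists_iterate (Nat.succ_pos d) (by omega)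
  have := tribSum_lt j
  omega

theorem cubeRoot_injective {k k' o o' : ℕ} (ho : 2 * trib k + o ≤ tribSum k)
    (ho' : 2 * trib k' + o' ≤ tribSum k') (h : cubeRoot k o = cubeRoot k' o') :
    k = k' ∧ o = o' := by
  have hl := congrArg List.length h
  simp only [cubeRoot, length_factor] at hl
  obtain rfl := trib_strictMono.injective hl
  have h1 := cubeRoot_offset_not_lt ho' h
  have h2 := cubeRoot_offset_not_lt ho h.symm
  exact ⟨rfl, by omega⟩

/-- The number of distinct cubes of period `trib k` in the Tribonacci word. -/
def cubeCount (k : ℕ) : ℕ := tribSum k + 1 - 2 * trib k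

theorem C_eq_sum {n K : ℕ} (h : n < trib (K + 3) + 2 * trib K) :
    C n = ∑ k ∈ Finset.range K, min (cubeCount k) (n + 1 - (trib (k + 3) + 2 * trib k)) := by
  let S : Finset (Σ _ : ℕ, ℕ) := (Finset.range K).sigma fun k =>
    Finset.range (min (cubeCount k) (n + 1 - (trib (k + 3) + 2 * trib k)))
  have hS : ∀ k o, (⟨k, o⟩ : Σ _ : ℕ, ℕ) ∈ S ↔
      2 * trib k + o ≤ tribSum k ∧ trib (k + 3) + 2 * trib k + o ≤ n := by
    intro k o
    simp only [S, Finset.mem_sigma, Finset.mem_range, lt_min_iff, cubeCount]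
    constructor
    · rintro ⟨-, h1, h2⟩
      omega
    · rintro ⟨h1, h2⟩
      refine ⟨?_, by omega, by omega⟩
      by_contra! hc
      have h3 := trib_strictMono.monotone hc
      have h4 := trib_strictMono.monotone (Nat.add_le_add_right hc 3)
      omega
  rw [C, Nat.subtype_card (S.image fun q => cubeRoot q.1 q.2), Finset.card_image_of_injOn,
    Finset.card_sigma]
  · simp only [Finset.card_range]
  · rintro ⟨k, o⟩ hq ⟨k', o'⟩ hq' heq
    obtain ⟨rfl, rfl⟩ := cubeRoot_injective ((hS _ _).1 hq).1 ((hS _ _).1 hq').1 heq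
    rfl
  · intro w
    rw [cube_iff_eq_cubeRoot]
    simp only [Finset.mem_image, Sigma.exists, hS, and_assoc, eq_comm (a := w)]

theorem two_mul_cubeCount (j : ℕ) : 2 * cubeCount (j + 3) + 1 + trib j = trib (j + 2) := by
  have h := two_mul_tribSum (j + 3)
  have h0 := trib_add_three j
  have h1 := trib_add_three (j + 1)
  have h2 := trib_add_three (j + 2)
  have h3 := trib_succ_bounds j
  have h4 := trib_succ_bounds (j + 1)
  rw [cubeCount]
  simp only [Nat.add_assoc, Nat.reduceAdd] at *
  omega

theorem two_mul_sum_cubeCount (j : ℕ) :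
    2 * ∑ k ∈ Finset.range (j + 3), cubeCount k + (j + 3) = trib (j + 1) + trib j := by
  induction j with
  | zero => decide
  | succ j ih =>
    have h := two_mul_cubeCount j
    rw [Nat.add_right_comm, Finset.sum_range_succ]
    simp only [Nat.add_assoc, Nat.reduceAdd] at *
    omega

theorem C_eq_sum_cubeCount_add {n j : ℕ} (h : trib (j + 6) + 2 * trib (j + 3) ≤ n)
    (h' : n < trib (j + 7) + 2 * trib (j + 4)) :
    C n = ∑ k ∈ Finset.range (j + 3), cubeCount k +
      min (cubeCount (j + 3)) (n + 1 - (trib (j + 6) + 2 * trib (j + 3))) := by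
  rw [C_eq_sum (K := j + 4) h', Finset.sum_range_succ]
  congr 1
  refine Finset.sum_congr rfl fun k hk => min_eq_left ?_
  rw [Finset.mem_range] at hk
  have h1 := trib_strictMono.monotone (show k + 1 ≤ j + 3 from hk)
  have h2 := trib_strictMono.monotone (show k + 4 ≤ j + 6 by omega)
  have h3 := trib_add_three (k + 1)
  have h4 := trib_succ_bounds k
  have h5 := trib_succ_bounds (k + 1)
  have h6 := tribSum_lt k
  rw [cubeCount]
  simp only [Nat.add_assoc, Nat.reduceAdd] at *
  omega

theorem tribAux_mono : Monotone tribAux := by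
  refine monotone_nat_of_le_succ fun k => ?_
  match k with
  | 0 => decide
  | 1 => decide
  | k + 2 => exact (trib_succ_bounds k).1.le

theorem t_mono : Monotone t := fun _ _ h => tribAux_mono (Int.toNat_le_toNat (by omega))

end Tribonacci

theorem distinct_cubes_count :
    (∀ n : ℕ, 1 ≤ n → n ≤ 57 → C n = 0) ∧
    (∀ n : ℕ, 58 ≤ n → ∀ m : ℤ,
      (t (m - 1) : ℤ) + 2 * (t (m - 4) : ℤ) ≤ (n : ℤ) →
      (n : ℤ) < (t m : ℤ) + 2 * (t (m - 3) : ℤ) →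
      7 ≤ m ∧
      ((n : ℚ) ≤ (3 * (t (m - 1) : ℚ) - (t (m - 3) : ℚ) - 3) / 2 →
        (C n : ℚ) = (n : ℚ) - (4 * (t (m - 1) : ℚ) - (t (m - 2) : ℚ)
          - 3 * (t (m - 3) : ℚ) + (m : ℚ) - 6) / 2) ∧
      (¬((n : ℚ) ≤ (3 * (t (m - 1) : ℚ) - (t (m - 3) : ℚ) - 3) / 2) →
        (C n : ℚ) = ((t (m - 5) : ℚ) + (t (m - 6) : ℚ) - (m : ℚ) + 3) / 2)) := by
  refine ⟨fun n _ hn => ?_, fun n hn m h1 h2 => ?_⟩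
  · rw [Tribonacci.C_eq_sum (K := 3) (lt_of_le_of_lt hn (by decide))]
    refine Finset.sum_eq_zero fun k hk => ?_
    rw [Finset.mem_range] at hk
    have h0 : Tribonacci.cubeCount k = 0 := by
      interval_cases k <;> decide
    rw [h0, Nat.zero_min]
  have hm : 7 ≤ m := by
    by_contra! hc
    have h3 : t m ≤ 44 := Tribonacci.t_mono (show m ≤ 6 by omega)
    have h4 : t (m - 3) ≤ 7 := Tribonacci.t_mono (show m - 3 ≤ 3 by omega)
    omega
  obtain ⟨j, rfl⟩ : ∃ j : ℕ, m = j + 7 := ⟨(m - 7).toNat, by omega⟩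
  have ht : ∀ (i : ℕ) (z : ℤ), z = ((j + i : ℕ) : ℤ) → t z = Tribonacci.trib (j + i) := by
    rintro i _ rfl
    rfl
  rw [ht 6 _ (by push_cast; ring), ht 3 _ (by push_cast; ring)] at h1
  rw [ht 7 _ (by push_cast; ring), ht 4 _ (by push_cast; ring)] at h2
  rw [ht 6 _ (by push_cast; ring), ht 4 _ (by push_cast; ring), ht 5 _ (by push_cast; ring),
    ht 2 _ (by push_cast; ring), ht 1 _ (by push_cast; ring)]
  have hC := Tribonacci.C_eq_sum_cubeCount_add (n := n) (j := j) (by omega) (by omega)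
  have hsum := Tribonacci.two_mul_sum_cubeCount j
  have hcount := Tribonacci.two_mul_cubeCount j
  have r3 := Tribonacci.trib_add_three j
  have r4 := Tribonacci.trib_add_three (j + 1)
  have r5 := Tribonacci.trib_add_three (j + 2)
  have r6 := Tribonacci.trib_add_three (j + 3)
  simp only [Nat.add_assoc, Nat.reduceAdd] at r3 r4 r5 r6
  refine ⟨hm, fun hle => ?_, fun hle => ?_⟩
  · have hle' : 2 * n + Tribonacci.trib (j + 4) + 3 ≤ 3 * Tribonacci.trib (j + 6) := by
      have : (2 * n + Tribonacci.trib (j + 4) + 3 : ℚ) ≤ 3 * Tribonacci.trib (j + 6) := by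
        linarith
      exact_mod_cast this
    have key : 2 * C n + 4 * Tribonacci.trib (j + 6) + j + 1 =
        2 * n + Tribonacci.trib (j + 5) + 3 * Tribonacci.trib (j + 4) := by
      omega
    have key' : (2 * C n + 4 * Tribonacci.trib (j + 6) + j + 1 : ℚ) =
        2 * n + Tribonacci.trib (j + 5) + 3 * Tribonacci.trib (j + 4) := by
      exact_mod_cast key
    push_cast
    linarith
  · have hle' : 3 * Tribonacci.trib (j + 6) < 2 * n + Tribonacci.trib (j + 4) + 3 := by
      have : (3 * Tribonacci.trib (j + 6) : ℚ) < 2 * n + Tribonacci.trib (j + 4) + 3 := by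
        linarith
      exact_mod_cast this
    have key : 2 * C n + j + 4 = Tribonacci.trib (j + 2) + Tribonacci.trib (j + 1) := by
      omega
    have key' : (2 * C n + j + 4 : ℚ) =
        Tribonacci.trib (j + 2) + Tribonacci.trib (j + 1) := by
      exact_mod_cast key
    push_cast
    linarith
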